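/- arXiv:2207.13903 — 4 statements merged into one kernel-verified Lean document; each statement's English description precedes it below -/
import Mathlib

section
/- Let k be a positive integer, let a_0, b_0 > 0 and a_1, …, a_k, b_1, …, b_k > 0, and set a(x) = a_0·∏_{j=1}^k (x + a_j) and b(x) = b_0·∏_{j=1}^k (x + b_j) for x ≥ 0. If the interlacing condition b_1 ≤ a_1 ≤ b_2 ≤ a_2 ≤ … ≤ b_k ≤ a_k holds, then the double net {1/(b(m) + a(m)·n)}_{m,n ∈ ℤ₊} is a minimal joint completely monotone net. -/
noncomputable section

/-- Forward difference operator for sequences. -/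
def dSeq (s : ℕ → ℝ) : ℕ → ℝ := fun m => s (m + 1) - s m

/-- A sequence is completely monotone. -/
def CompMono (s : ℕ → ℝ) : Prop := ∀ k m : ℕ, 0 ≤ (-1 : ℝ) ^ k * dSeq^[k] s m

/-- A completely monotone sequence is minimal. -/
def MinCompMono (s : ℕ → ℝ) : Prop :=
  CompMono s ∧ ∀ ε : ℝ, 0 < ε → ¬ CompMono (fun k => s k - if k = 0 then ε else 0)

/-- First forward difference operator for double nets. -/
def d1 (a : ℕ → ℕ → ℝ) : ℕ → ℕ → ℝ := fun m n => a (m + 1) n - a m n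

/-- Second forward difference operator for double nets. -/
def d2 (a : ℕ → ℕ → ℝ) : ℕ → ℕ → ℝ := fun m n => a m (n + 1) - a m n

/-- A double net is joint completely monotone. -/
def JointCompMono (a : ℕ → ℕ → ℝ) : Prop :=
  ∀ β₁ β₂ m n : ℕ, 0 ≤ (-1 : ℝ) ^ (β₁ + β₂) * d1^[β₁] (d2^[β₂] a) m n

/-- A joint completely monotone double net is minimal. -/
def MinJointCompMono (a : ℕ → ℕ → ℝ) : Prop :=
  JointCompMono a ∧
    (∀ ε : ℝ, 0 < ε → ¬ CompMono (fun k => a k 0 - if k = 0 then ε else 0)) ∧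
    (∀ ε : ℝ, 0 < ε → ¬ CompMono (fun k => a 0 k - if k = 0 then ε else 0))

/-- The negated forward difference `s ↦ (m ↦ s m - s (m + 1))` as a linear map. -/
def negDiff : (ℕ → ℝ) →ₗ[ℝ] (ℕ → ℝ) where
  toFun s m := s m - s (m + 1)
  map_add' s t := by ext m; simp only [Pi.add_apply]; ring
  map_smul' c s := by ext m; simp only [Pi.smul_apply, smul_eq_mul, RingHom.id_apply]; ring

lemma negDiff_apply (s : ℕ → ℝ) (m : ℕ) : negDiff s m = s m - s (m + 1) := rfl

lemma negDiff_pow_succ (k : ℕ) (s : ℕ → ℝ) :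
    (negDiff ^ (k + 1)) s = (negDiff ^ k) (negDiff s) := by
  rw [pow_succ, Module.End.mul_apply]

lemma negDiff_pow_succ_apply (k : ℕ) (s : ℕ → ℝ) (m : ℕ) :
    (negDiff ^ (k + 1)) s m = (negDiff ^ k) s m - (negDiff ^ k) s (m + 1) := by
  rw [pow_succ', Module.End.mul_apply, negDiff_apply]

lemma neg_one_pow_mul_dSeq_iterate (k : ℕ) (s : ℕ → ℝ) (m : ℕ) :
    (-1 : ℝ) ^ k * dSeq^[k] s m = (negDiff ^ k) s m := by
  induction k generalizing m with
  | zero => simp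
  | succ k ih =>
    rw [Function.iterate_succ_apply', negDiff_pow_succ_apply, ← ih, ← ih, dSeq]
    ring

lemma compMono_iff {s : ℕ → ℝ} : CompMono s ↔ ∀ k m, 0 ≤ (negDiff ^ k) s m := by
  simp only [CompMono, neg_one_pow_mul_dSeq_iterate]

namespace CompMono

variable {s t : ℕ → ℝ}

lemma nonneg (hs : CompMono s) (m : ℕ) : 0 ≤ s m := by
  simpa using hs 0 m

lemma negDiff (hs : CompMono s) : CompMono (negDiff s) := by
  rw [compMono_iff] at hs ⊢
  intro k m
  rw [← negDiff_pow_succ]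
  exact hs (k + 1) m

lemma shift (hs : CompMono s) : CompMono (fun m => s (m + 1)) := by
  rw [compMono_iff] at hs ⊢
  have key : ∀ k m, (_root_.negDiff ^ k) (fun m => s (m + 1)) m =
      (_root_.negDiff ^ k) s (m + 1) := by
    intro k
    induction k with
    | zero => simp
    | succ k ih => intro m; rw [negDiff_pow_succ_apply, negDiff_pow_succ_apply, ih, ih]
  intro k m
  rw [key]
  exact hs k (m + 1)

lemma add (hs : CompMono s) (ht : CompMono t) : CompMono (fun m => s m + t m) := by
  rw [compMono_iff] at hs ht ⊢
  intro k m
  have : (fun m => s m + t m) = s + t := rfl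
  rw [this, map_add]
  exact add_nonneg (hs k m) (ht k m)

lemma const {c : ℝ} (hc : 0 ≤ c) : CompMono (fun _ => c) := by
  rw [compMono_iff]
  rintro (_ | k) m
  · simpa using hc
  · have : _root_.negDiff (fun _ => c) = 0 := by
      ext m
      simp [negDiff_apply]
    rw [negDiff_pow_succ, this, map_zero]
    rfl

lemma mul (hs : CompMono s) (ht : CompMono t) : CompMono (fun m => s m * t m) := by
  rw [compMono_iff]
  intro k
  induction k generalizing s t with
  | zero => intro m; simpa using mul_nonneg (hs.nonneg m) (ht.nonneg m)
  | succ k ih =>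
    intro m
    have : _root_.negDiff (fun m => s m * t m) =
        (fun m => _root_.negDiff s m * t (m + 1)) + (fun m => s m * _root_.negDiff t m) := by
      ext m
      simp only [negDiff_apply, Pi.add_apply]
      ring
    rw [negDiff_pow_succ, this, map_add]
    exact add_nonneg (ih hs.negDiff ht.shift m) (ih hs ht.negDiff m)

lemma pow (hs : CompMono s) (p : ℕ) : CompMono (fun m => s m ^ p) := by
  induction p with
  | zero => simpa using const zero_le_one
  | succ p ih => simpa only [pow_succ] using ih.mul hs

lemma sum {ι : Type*} (S : Finset ι) {f : ι → ℕ → ℝ} (hf : ∀ i ∈ S, CompMono (f i)) :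
    CompMono (fun m => ∑ i ∈ S, f i m) := by
  classical
  induction S using Finset.induction_on with
  | empty => simpa using const le_rfl
  | insert i S hi ih =>
    simp only [Finset.sum_insert hi]
    exact (hf i (by simp)).add (ih fun j hj => hf j (by simp [hj]))

lemma prod {ι : Type*} (S : Finset ι) {f : ι → ℕ → ℝ} (hf : ∀ i ∈ S, CompMono (f i)) :
    CompMono (fun m => ∏ i ∈ S, f i m) := by
  classical
  induction S using Finset.induction_on with
  | empty => simpa using const zero_le_one
  | insert i S hi ih =>
    simp only [Finset.prod_insert hi]
    exact (hf i (by simp)).mul (ih fun j hj => hf j (by simp [hj]))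

lemma of_tendsto {f : ℕ → ℕ → ℝ} (hf : ∀ N, CompMono (f N))
    (h : ∀ m, Filter.Tendsto (fun N => f N m) Filter.atTop (nhds (s m))) : CompMono s := by
  simp only [compMono_iff] at hf ⊢
  have key : ∀ k m, Filter.Tendsto (fun N => (_root_.negDiff ^ k) (f N) m) Filter.atTop
      (nhds ((_root_.negDiff ^ k) s m)) := by
    intro k
    induction k with
    | zero => simpa using h
    | succ k ih =>
      intro m
      simp only [negDiff_pow_succ_apply]
      exact (ih m).sub (ih (m + 1))
  exact fun k m => ge_of_tendsto' (key k m) fun N => hf N k m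

/-- If `s` is completely monotone with `s < K`, then so is `1 / (K - s)`. -/
lemma one_div_const_sub (hs : CompMono s) {K : ℝ} (hK : 0 < K) (h : ∀ m, s m < K) :
    CompMono (fun m => 1 / (K - s m)) := by
  refine of_tendsto (f := fun N m => ∑ p ∈ Finset.range N, K⁻¹ * (s m * K⁻¹) ^ p)
    (fun N => sum _ fun p _ => (const (inv_nonneg.2 hK.le)).mul
      ((hs.mul (const (inv_nonneg.2 hK.le))).pow p)) fun m => ?_
  have h1 : s m * K⁻¹ < 1 := by
    rw [← div_eq_mul_inv, div_lt_one hK]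
    exact h m
  have h0 : 0 ≤ s m * K⁻¹ := mul_nonneg (hs.nonneg m) (inv_nonneg.2 hK.le)
  have hsum := ((hasSum_geometric_of_lt_one h0 h1).mul_left K⁻¹).tendsto_sum_nat
  convert hsum using 2
  have : K - s m ≠ 0 := (sub_pos.2 (h m)).ne'
  have : 1 - s m * K⁻¹ ≠ 0 := (sub_pos.2 h1).ne'
  rw [← mul_inv, mul_sub, mul_one, mul_comm (s m), mul_inv_cancel_left₀ hK.ne', one_div]

end CompMono

lemma negDiff_pow_one_div {y : ℝ} (hy : 0 < y) (k n : ℕ) :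
    (negDiff ^ k) (fun n => 1 / ((n : ℝ) + y)) n =
      k.factorial * ∏ i ∈ Finset.range (k + 1), 1 / (((n + i : ℕ) : ℝ) + y) := by
  induction k generalizing n with
  | zero => simp
  | succ k ih =>
    rw [negDiff_pow_succ_apply, ih, ih, Finset.prod_range_succ' _ k, Finset.prod_range_succ _ k,
      Finset.prod_range_succ' _ (k + 1), Finset.prod_range_succ _ k, Nat.factorial_succ]
    have hp : ∏ i ∈ Finset.range k, 1 / (((n + 1 + i : ℕ) : ℝ) + y) =
        ∏ i ∈ Finset.range k, 1 / (((n + (i + 1) : ℕ) : ℝ) + y) :=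
      Finset.prod_congr rfl fun i _ => by rw [add_assoc n 1 i, add_comm 1 i]
    rw [hp]
    have h1 : (n : ℝ) + y ≠ 0 := by positivity
    have h2 : (n : ℝ) + 1 + k + y ≠ 0 := by positivity
    have h3 : (n : ℝ) + (k + 1) + y ≠ 0 := by positivity
    push_cast
    field_simp
    ring

lemma compMono_one_div {y : ℝ} (hy : 0 < y) : CompMono (fun n => 1 / ((n : ℝ) + y)) := by
  rw [compMono_iff]
  intro k n
  rw [negDiff_pow_one_div hy]
  positivity

/-- The quotient `∏_{j<k} (x + b_{j+1}) / ∏_{j≤k} (x + a_j)` is completely monotone when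
`a_j ≤ b_{j+1}`. -/
lemma compMono_shifted_quotient (k : ℕ) {A B : ℕ → ℝ} (hA : ∀ j ≤ k, 0 < A j)
    (hAB : ∀ j < k, A j ≤ B (j + 1)) :
    CompMono (fun m => (∏ j ∈ Finset.range k, ((m : ℝ) + B (j + 1)) / ((m : ℝ) + A (j + 1))) *
      (1 / ((m : ℝ) + A 0))) := by
  have h := (CompMono.prod (Finset.range k)
    (f := fun j m => 1 + (B (j + 1) - A j) * (1 / ((m : ℝ) + A j))) fun j hj => by
      have hj := Finset.mem_range.1 hj
      exact (CompMono.const zero_le_one).add ((CompMono.const (sub_nonneg.2 (hAB j hj))).mul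
        (compMono_one_div (hA j hj.le)))).mul (compMono_one_div (hA k le_rfl))
  convert h using 2 with m
  clear h
  induction k with
  | zero => simp
  | succ k ih =>
    have ih := ih (fun j hj => hA j (by omega)) (fun j hj => hAB j (by omega))
    have h0 := hA k (by omega)
    have h1 := hA (k + 1) le_rfl
    have h2 : (m : ℝ) + A k ≠ 0 := by positivity
    have h3 : (m : ℝ) + A (k + 1) ≠ 0 := by positivity
    rw [Finset.prod_range_succ, Finset.prod_range_succ, mul_right_comm, ih]
    field_simp
    ring

lemma compMono_one_sub_quotient (k : ℕ) {A B : ℕ → ℝ} (hA : ∀ j < k, 0 < A j)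
    (hBA : ∀ j < k, B j ≤ A j) (hAB : ∀ j, j + 1 < k → A j ≤ B (j + 1)) :
    CompMono (fun m => 1 - ∏ j ∈ Finset.range k, ((m : ℝ) + B j) / ((m : ℝ) + A j)) := by
  induction k generalizing A B with
  | zero => simpa using CompMono.const le_rfl
  | succ k ih =>
    have h1 := ih (A := fun j => A (j + 1)) (B := fun j => B (j + 1))
      (fun j hj => hA _ (by omega)) (fun j hj => hBA _ (by omega)) (fun j hj => hAB _ (by omega))
    have h2 := compMono_shifted_quotient k (A := A) (B := B) (fun j hj => hA _ (by omega))
      (fun j hj => hAB _ (by omega))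
    have h3 := h1.add ((CompMono.const (sub_nonneg.2 (hBA 0 (by omega)))).mul h2)
    convert h3 using 2 with m
    have h0 := hA 0 (by omega)
    have h4 : (m : ℝ) + A 0 ≠ 0 := by positivity
    rw [Finset.prod_range_succ']
    field_simp
    ring

lemma tendsto_negDiff_pow_one_div {y : ℝ} (hy : 0 < y) :
    Filter.Tendsto (fun k => (negDiff ^ k) (fun n => 1 / ((n : ℝ) + y)) 0) Filter.atTop
      (nhds 0) := by
  have h1 : Filter.Tendsto (fun k : ℕ => ((k : ℝ) ^ y)⁻¹) Filter.atTop (nhds 0) :=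
    ((tendsto_rpow_atTop hy).comp tendsto_natCast_atTop_atTop).inv_tendsto_atTop
  have h2 := (Real.GammaSeq_tendsto_Gamma y).mul h1
  rw [mul_zero] at h2
  refine h2.congr' ?_
  filter_upwards [Filter.eventually_gt_atTop 0] with k hk
  have hk : (0 : ℝ) < k := by exact_mod_cast hk
  have : (k : ℝ) ^ y ≠ 0 := (Real.rpow_pos_of_pos hk y).ne'
  rw [negDiff_pow_one_div hy, Real.GammaSeq]
  simp only [zero_add, one_div, Finset.prod_inv_distrib, add_comm _ y]
  field_simp

lemma negDiff_pow_single (ε : ℝ) (k : ℕ) :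
    (negDiff ^ k) (fun n => if n = 0 then ε else 0) = fun n => if n = 0 then ε else 0 := by
  induction k with
  | zero => rfl
  | succ k ih =>
    have : negDiff (fun n => if n = 0 then ε else 0) = fun n => if n = 0 then ε else 0 := by
      ext n
      simp [negDiff_apply]
    rw [negDiff_pow_succ, this, ih]

/-- A sequence dominated, in the order given by complete monotonicity, by `C / (n + y)` has no
point mass at zero that can be removed. -/
lemma not_compMono_sub_single {s : ℕ → ℝ} {C y : ℝ} (hy : 0 < y)
    (h : CompMono (fun n => C * (1 / ((n : ℝ) + y)) - s n)) {ε : ℝ} (hε : 0 < ε) :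
    ¬ CompMono (fun n => s n - if n = 0 then ε else 0) := by
  intro hs
  have hlim := (tendsto_negDiff_pow_one_div hy).const_mul C
  rw [mul_zero] at hlim
  refine hε.not_ge (ge_of_tendsto' hlim fun k => ?_)
  have h1 := compMono_iff.1 (h.add hs) k 0
  have h2 : (fun n : ℕ => C * (1 / ((n : ℝ) + y)) - s n + (s n - if n = 0 then ε else 0)) =
      C • (fun n : ℕ => 1 / ((n : ℝ) + y)) - fun n => if n = 0 then ε else 0 := by
    ext n
    simp
  rw [h2, map_sub, map_smul, negDiff_pow_single] at h1
  simpa using h1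

lemma exists_pos_forall_lt (k : ℕ) {B : ℕ → ℝ} (hB : ∀ j < k, 0 < B j) :
    ∃ y, 0 < y ∧ ∀ j < k, y < B j := by
  induction k with
  | zero => exact ⟨1, one_pos, by simp⟩
  | succ k ih =>
    obtain ⟨y, hy, h⟩ := ih fun j hj => hB j (by omega)
    have hk := hB k (by omega)
    refine ⟨min y (B k / 2), lt_min hy (by linarith), fun j hj => ?_⟩
    rcases Nat.lt_succ_iff_lt_or_eq.1 hj with hj | rfl
    · exact (min_le_left _ _).trans_lt (h j hj)
    · exact (min_le_right _ _).trans_lt (by linarith)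

lemma exists_compMono_sub_prod (k : ℕ) {B : ℕ → ℝ} {y : ℝ} (hy : 0 < y)
    (hB : ∀ j < k + 1, y < B j) :
    ∃ C, 0 ≤ C ∧ CompMono (fun m => C * (1 / ((m : ℝ) + y)) -
      ∏ j ∈ Finset.range (k + 1), 1 / ((m : ℝ) + B j)) := by
  induction k with
  | zero =>
    have h0 := hB 0 (by omega)
    have h0' := hy.trans h0
    refine ⟨1, zero_le_one, ?_⟩
    convert (CompMono.const (sub_nonneg.2 h0.le)).mul
      ((compMono_one_div hy).mul (compMono_one_div h0')) using 2 with m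
    have h1 : (m : ℝ) + y ≠ 0 := by positivity
    have h2 : (m : ℝ) + B 0 ≠ 0 := by positivity
    rw [Finset.prod_range_one]
    field_simp
    ring
  | succ k ih =>
    obtain ⟨C, hC, h⟩ := ih fun j hj => hB j (by omega)
    have h0 := hB (k + 1) (by omega)
    have h0' := hy.trans h0
    have hd := sub_pos.2 h0
    refine ⟨C / (B (k + 1) - y), by positivity, ?_⟩
    convert (h.mul (compMono_one_div h0')).add
      ((CompMono.const (c := C / (B (k + 1) - y)) (by positivity)).mul
        (compMono_one_div h0')) using 2 with m
    have h1 : (m : ℝ) + y ≠ 0 := by positivity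
    have h2 : (m : ℝ) + B (k + 1) ≠ 0 := by positivity
    rw [Finset.prod_range_succ _ (k + 1)]
    field_simp
    ring

lemma d1_d2_iterate_eq (a : ℕ → ℕ → ℝ) (β₁ β₂ m n : ℕ) :
    (-1 : ℝ) ^ (β₁ + β₂) * d1^[β₁] (d2^[β₂] a) m n =
      (negDiff ^ β₁) (fun m => (negDiff ^ β₂) (a m) n) m := by
  induction β₁ generalizing m with
  | zero =>
    simp only [zero_add, Function.iterate_zero, id_eq, pow_zero, Module.End.one_apply]
    induction β₂ generalizing n with
    | zero => simp
    | succ β₂ ih =>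
      rw [Function.iterate_succ_apply', negDiff_pow_succ_apply, ← ih, ← ih, d2]
      ring
  | succ β₁ ih =>
    rw [Function.iterate_succ_apply', negDiff_pow_succ_apply, ← ih, ← ih, d1]
    ring

lemma jointCompMono_one_div {p q : ℕ → ℝ} (hp : CompMono (fun m => 1 / p m))
    (hp0 : ∀ m, 0 < p m) (hq0 : ∀ m, 0 < q m)
    (hq : ∀ i : ℕ, CompMono (fun m => 1 / ((i : ℝ) + q m / p m))) :
    JointCompMono (fun m n => 1 / (q m + p m * n)) := by
  intro β₁ β₂ m n
  rw [d1_d2_iterate_eq]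
  have key : (fun m => (negDiff ^ β₂) (fun n : ℕ => 1 / (q m + p m * n)) n) = fun m =>
      1 / p m * (β₂.factorial *
        ∏ i ∈ Finset.range (β₂ + 1), 1 / (((n + i : ℕ) : ℝ) + q m / p m)) := by
    ext m
    have h := hp0 m
    have h' := hq0 m
    have heq : (fun n : ℕ => 1 / (q m + p m * n)) =
        (1 / p m) • fun n : ℕ => 1 / ((n : ℝ) + q m / p m) := by
      ext n
      simp only [Pi.smul_apply, smul_eq_mul]
      field_simp
      ring
    rw [heq, map_smul, Pi.smul_apply, smul_eq_mul, negDiff_pow_one_div (div_pos h' h)]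
  rw [key]
  exact compMono_iff.1 (hp.mul ((CompMono.const (by positivity)).mul
    (CompMono.prod _ fun i _ => hq (n + i)))) β₁ m

theorem statement0 (k : ℕ) (hk : 0 < k) (a₀ b₀ : ℝ) (ha₀ : 0 < a₀) (hb₀ : 0 < b₀)
    (A B : ℕ → ℝ)
    (hA : ∀ j, 1 ≤ j → j ≤ k → 0 < A j) (hB : ∀ j, 1 ≤ j → j ≤ k → 0 < B j)
    (hBA : ∀ j, 1 ≤ j → j ≤ k → B j ≤ A j)
    (hAB : ∀ j, 1 ≤ j → j < k → A j ≤ B (j + 1)) :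
    MinJointCompMono (fun m n =>
      1 / (b₀ * ∏ j ∈ Finset.Icc 1 k, ((m : ℝ) + B j) +
        (a₀ * ∏ j ∈ Finset.Icc 1 k, ((m : ℝ) + A j)) * n)) := by
  have hprod : ∀ (F : ℕ → ℝ) (m : ℕ), ∏ j ∈ Finset.Icc 1 k, ((m : ℝ) + F j) =
      ∏ j ∈ Finset.range k, ((m : ℝ) + F (j + 1)) := by
    intro F m
    rw [Finset.range_eq_Ico, Finset.prod_Ico_add' (fun j => (m : ℝ) + F j) 0 k 1]
    rfl
  simp only [hprod]
  replace hA : ∀ j < k, 0 < A (j + 1) := fun j hj => hA _ (by omega) (by omega)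
  replace hB : ∀ j < k, 0 < B (j + 1) := fun j hj => hB _ (by omega) (by omega)
  replace hBA : ∀ j < k, B (j + 1) ≤ A (j + 1) := fun j hj => hBA _ (by omega) (by omega)
  replace hAB : ∀ j, j + 1 < k → A (j + 1) ≤ B (j + 1 + 1) := fun j hj =>
    hAB _ (by omega) (by omega)
  have hpos : ∀ F : ℕ → ℝ, (∀ j < k, 0 < F (j + 1)) → ∀ m : ℕ,
      0 < ∏ j ∈ Finset.range k, ((m : ℝ) + F (j + 1)) := fun F hF m =>
    Finset.prod_pos fun j hj => add_pos_of_nonneg_of_pos m.cast_nonneg (hF j (Finset.mem_range.1 hj))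
  have hpA := hpos A hA
  have hpB := hpos B hB
  refine ⟨jointCompMono_one_div ?_ (fun m => mul_pos ha₀ (hpA m)) (fun m => mul_pos hb₀ (hpB m)) ?_,
    fun ε hε => ?_, fun ε hε => ?_⟩
  · convert (CompMono.const (one_div_pos.2 ha₀).le).mul (CompMono.prod (Finset.range k)
      fun j hj => compMono_one_div (hA j (Finset.mem_range.1 hj))) using 2 with m
    simp [mul_comm]
  · intro i
    have hc : 0 < b₀ / a₀ := div_pos hb₀ ha₀
    have hquot := compMono_one_sub_quotient k (A := fun j => A (j + 1)) (B := fun j => B (j + 1))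
      hA hBA hAB
    have heq : ∀ m : ℕ, (i : ℝ) + b₀ * (∏ j ∈ Finset.range k, ((m : ℝ) + B (j + 1))) /
        (a₀ * ∏ j ∈ Finset.range k, ((m : ℝ) + A (j + 1))) = (i + b₀ / a₀) - b₀ / a₀ *
          (1 - ∏ j ∈ Finset.range k, ((m : ℝ) + B (j + 1)) / ((m : ℝ) + A (j + 1))) := by
      intro m
      rw [Finset.prod_div_distrib, mul_div_mul_comm]
      ring
    simp only [heq]
    refine ((CompMono.const hc.le).mul hquot).one_div_const_sub (by positivity) fun m => ?_
    rw [← sub_pos, ← heq]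
    have := hpA m
    have := hpB m
    positivity
  · obtain ⟨k, rfl⟩ := Nat.exists_eq_succ_of_ne_zero hk.ne'
    obtain ⟨y, hy, hyB⟩ := exists_pos_forall_lt _ (B := fun j => B (j + 1)) hB
    obtain ⟨C, -, hC⟩ := exists_compMono_sub_prod k hy hyB
    refine not_compMono_sub_single (C := 1 / b₀ * C) hy ?_ hε
    convert (CompMono.const (one_div_pos.2 hb₀).le).mul hC using 2 with m
    simp
    ring
  · refine not_compMono_sub_single
      (C := 1 / (a₀ * ∏ j ∈ Finset.range k, (((0 : ℕ) : ℝ) + A (j + 1))))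
      (y := b₀ * (∏ j ∈ Finset.range k, (((0 : ℕ) : ℝ) + B (j + 1))) /
        (a₀ * ∏ j ∈ Finset.range k, (((0 : ℕ) : ℝ) + A (j + 1)))) ?_ ?_ hε
    · exact div_pos (mul_pos hb₀ (hpB 0)) (mul_pos ha₀ (hpA 0))
    · convert CompMono.const le_rfl using 2 with n
      have h1 := hpA 0
      have h2 := hpB 0
      rw [sub_eq_zero]
      field_simp
      ring
end
end

section
/- Let k be a positive integer, let a_0, b_0 > 0 and a_1, …, a_k, b_1, …, b_k > 0, and set a(x) = a_0·∏_{j=1}^k (x + a_j) and b(x) = b_0·∏_{j=1}^k (x + b_j) for x ≥ 0. If the double net {1/(b(m) + a(m)·n)}_{m,n ∈ ℤ₊} is joint completely monotone, then the following three inequalities hold: (1) ∑_{j=1}^k 1/a_j ≤ ∑_{j=1}^k 1/b_j; (2) ∏_{j=1}^k b_j ≤ ∏_{j=1}^k a_j; (3) ∑_{j=1}^k b_j ≤ ∑_{j=1}^k a_j. -/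
noncomputable section

open Complex Metric Filter Topology

lemma one_add_sum_range_le_prod_one_add {x : ℕ → ℝ} (hx : ∀ i, 0 ≤ x i) (n : ℕ) :
    1 + ∑ i ∈ Finset.range n, x i ≤ ∏ i ∈ Finset.range n, (1 + x i) := by
  induction n with
  | zero => simp
  | succ n ih =>
    rw [Finset.sum_range_succ, Finset.prod_range_succ]
    nlinarith [hx n, Finset.sum_nonneg fun i (_ : i ∈ Finset.range n) => hx i]

lemma tendsto_sum_range_div_add_atTop {c x : ℝ} (hc : 0 < c) (hx : 0 < x) :
    Tendsto (fun n => ∑ i ∈ Finset.range n, c / (x + i)) atTop atTop := by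
  have hpos : 0 < c / (x + 1) := by positivity
  refine tendsto_atTop_mono (fun n => ?_)
    (Real.tendsto_sum_range_one_div_nat_succ_atTop.const_mul_atTop hpos)
  rw [Finset.mul_sum]
  refine Finset.sum_le_sum fun i _ => ?_
  rw [div_mul_div_comm, mul_one]
  have hi : (0 : ℝ) ≤ i := i.cast_nonneg
  gcongr
  nlinarith

lemma tendsto_prod_range_one_add_div_atTop {c x : ℝ} (hc : 0 < c) (hx : 0 < x) :
    Tendsto (fun n => ∏ i ∈ Finset.range n, (1 + c / (x + i))) atTop atTop :=
  tendsto_atTop_mono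
    (fun n => one_add_sum_range_le_prod_one_add (fun i => by positivity) n)
    (tendsto_atTop_add_const_left _ 1 (tendsto_sum_range_div_add_atTop hc hx))

lemma cast_iterate_dSeq_eq_circleIntegral {f : ℂ → ℂ} {s : ℕ → ℝ} {n : ℕ} {d : ℝ} (hd : 0 < d)
    (hf : DiffContOnCl ℂ f (ball (n : ℂ) (n + d))) (hs : ∀ m : ℕ, f m = s m) (j m : ℕ)
    (hmj : m + j ≤ n) :
    ((dSeq^[j] s m : ℝ) : ℂ) = (2 * Real.pi * I : ℂ)⁻¹ • ∮ w in C((n : ℂ), n + d),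
      (j.factorial / ∏ i ∈ Finset.range (j + 1), (w - (m + i : ℕ))) * f w := by
  have hR : (0 : ℝ) ≤ n + d := by positivity
  have hball : ∀ m : ℕ, m ≤ n → (m : ℂ) ∈ ball (n : ℂ) (n + d) := by
    intro m hm
    rw [mem_ball, dist_eq, ← ofReal_natCast, ← ofReal_natCast, ← ofReal_sub, norm_real,
      Real.norm_eq_abs, abs_lt]
    have : (m : ℝ) ≤ n := by exact_mod_cast hm
    constructor <;> linarith [m.cast_nonneg (α := ℝ)]
  have hne : ∀ w ∈ sphere (n : ℂ) (n + d), ∀ m : ℕ, m ≤ n → w - m ≠ 0 := by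
    intro w hw m hm h
    exact sphere_disjoint_ball.ne_of_mem hw (hball m hm) (sub_eq_zero.mp h)
  have hfc : ContinuousOn f (sphere (n : ℂ) (n + d)) :=
    hf.continuousOn_ball.mono sphere_subset_closedBall
  have hint : ∀ j m : ℕ, m + j ≤ n → CircleIntegrable (fun w : ℂ =>
      (j.factorial / ∏ i ∈ Finset.range (j + 1), (w - (m + i : ℕ))) * f w) n (n + d) := by
    intro j m hmj
    refine ContinuousOn.circleIntegrable hR (ContinuousOn.mul (ContinuousOn.div continuousOn_const
      (by fun_prop) fun w hw => Finset.prod_ne_zero_iff.2 fun i hi => hne w hw _ ?_) hfc)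
    have := Finset.mem_range.1 hi
    omega
  induction j generalizing m with
  | zero =>
    have h := hf.two_pi_i_inv_smul_circleIntegral_sub_inv_smul (hball m (by omega))
    simpa [← hs] using h.symm
  | succ j ih =>
    rw [Function.iterate_succ_apply', dSeq, ofReal_sub, ih m (by omega), ih (m + 1) (by omega),
      ← smul_sub, ← circleIntegral.integral_sub (hint j _ (by omega)) (hint j _ (by omega))]
    congr 1
    refine circleIntegral.integral_congr hR fun w hw => ?_
    have hm0 := hne w hw m (by omega)
    have hm1 := hne w hw (m + j + 1) (by omega)
    have hmid : ∏ i ∈ Finset.range j, (w - (m + 1 + i : ℕ)) ≠ 0 :=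
      Finset.prod_ne_zero_iff.2 fun i hi => hne w hw _ (by have := Finset.mem_range.1 hi; omega)
    have e1 : ∏ i ∈ Finset.range (j + 1), (w - (m + i : ℕ)) =
        (w - m) * ∏ i ∈ Finset.range j, (w - (m + 1 + i : ℕ)) := by
      rw [Finset.prod_range_succ', mul_comm]
      congr 1
      exact Finset.prod_congr rfl fun i _ => by push_cast; ring
    have e2 : ∏ i ∈ Finset.range (j + 1), (w - (m + 1 + i : ℕ)) =
        (∏ i ∈ Finset.range j, (w - (m + 1 + i : ℕ))) * (w - (m + j + 1 : ℕ)) := by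
      rw [Finset.prod_range_succ]
      congr 1
      push_cast; ring
    have e3 : ∏ i ∈ Finset.range (j + 1 + 1), (w - (m + i : ℕ)) =
        (w - m) * (∏ i ∈ Finset.range j, (w - (m + 1 + i : ℕ))) * (w - (m + j + 1 : ℕ)) := by
      rw [Finset.prod_range_succ, e1]
      congr 1
    simp only [e1, e2, e3, Nat.factorial_succ]
    field_simp
    push_cast
    ring

lemma newton_kernel {w : ℂ} (n : ℕ) (hw : ∀ m ≤ n, w - (m : ℂ) ≠ 0) :
    (w ^ 2)⁻¹ = ∑ l ∈ Finset.range n, (-1) ^ l / ((l : ℂ) + 1) *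
        ((l + 1).factorial / ∏ i ∈ Finset.range (l + 1 + 1), (w - (0 + i : ℕ))) +
      (-1) ^ n * n.factorial / (w * ∏ i ∈ Finset.range (n + 1), (w - (0 + i : ℕ))) := by
  have hw0 : w ≠ 0 := by simpa using hw 0 (by omega)
  induction n with
  | zero => simp [pow_two]
  | succ n ih =>
    rw [ih fun m hm => hw m (by omega), Finset.sum_range_succ, add_assoc]
    congr 1
    have hp : ∏ i ∈ Finset.range (n + 1), (w - (0 + i : ℕ)) ≠ 0 :=
      Finset.prod_ne_zero_iff.2 fun i hi => by
        simpa using hw i (by have := Finset.mem_range.1 hi; omega)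
    have hn := hw (n + 1) le_rfl
    have hn1 : (n : ℂ) + 1 ≠ 0 := by exact_mod_cast n.succ_ne_zero
    rw [Finset.prod_range_succ _ (n + 1), Nat.factorial_succ, zero_add, pow_succ]
    generalize ∏ i ∈ Finset.range (n + 1), (w - (0 + i : ℕ)) = p at *
    push_cast at hn ⊢
    field_simp
    ring

lemma norm_circleAverage_le_of_norm_le_mul_poissonKernel {g : ℂ → ℂ} {c w : ℂ} {R M : ℝ}
    (hw : w ∈ ball c R) (hg : ∀ z ∈ sphere c R, ‖g z‖ ≤ M * poissonKernel c w z) :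
    ‖Real.circleAverage g c R‖ ≤ M := by
  have hR : 0 < R := pos_of_mem_ball hw
  have hcont : Continuous fun θ : ℝ => poissonKernel c w (circleMap c R θ) := by
    unfold poissonKernel
    refine Continuous.div (by fun_prop) (by fun_prop) fun θ => ?_
    rw [sub_sub_sub_cancel_right]
    refine pow_ne_zero 2 (norm_ne_zero_iff.2 (sub_ne_zero.2 ?_))
    exact sphere_disjoint_ball.ne_of_mem (circleMap_mem_sphere c hR.le θ) hw
  have havg : (2 * Real.pi)⁻¹ * ∫ θ in 0..2 * Real.pi, poissonKernel c w (circleMap c R θ) = 1 := by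
    have h := DiffContOnCl.circleAverage_poissonKernel_smul (f := fun _ : ℂ => (1 : ℂ))
      diffContOnCl_const hw
    simp only [Real.circleAverage_def, Pi.smul_apply', real_smul, mul_one] at h
    rw [intervalIntegral.integral_ofReal] at h
    exact_mod_cast h
  rw [Real.circleAverage_def, norm_smul, Real.norm_of_nonneg (by positivity)]
  calc (2 * Real.pi)⁻¹ * ‖∫ θ in 0..2 * Real.pi, g (circleMap c R θ)‖
      ≤ (2 * Real.pi)⁻¹ * ∫ θ in 0..2 * Real.pi, M * poissonKernel c w (circleMap c R θ) := by
        gcongr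
        exact intervalIntegral.norm_integral_le_of_norm_le (by positivity)
          (Eventually.of_forall fun θ _ => hg _ (circleMap_mem_sphere c hR.le θ))
          ((hcont.const_mul M).intervalIntegrable _ _)
    _ = M := by
        rw [intervalIntegral.integral_const_mul, mul_left_comm, havg, mul_one]

lemma norm_deriv_sub_newton_le {f : ℂ → ℂ} {s : ℕ → ℝ} {d C : ℝ} (hd : 0 < d)
    (hf : ∀ z : ℂ, -(2 * d) < z.re → DifferentiableAt ℂ f z)
    (hb : ∀ z : ℂ, -(2 * d) < z.re → ‖f z‖ ≤ C) (hs : ∀ m : ℕ, f m = s m) (n : ℕ) :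
    ‖deriv f 0 - ∑ l ∈ Finset.range n, (-1) ^ l / ((l : ℂ) + 1) * (dSeq^[l + 1] s 0 : ℝ)‖ ≤
      C / d * (∏ i ∈ Finset.range n, (1 + d / (1 + (i : ℝ))))⁻¹ := by
  have hn0 : (0 : ℝ) ≤ n := n.cast_nonneg
  have hR : (0 : ℝ) ≤ n + d := by positivity
  have hre : ∀ w ∈ closedBall (n : ℂ) (n + d), -(2 * d) < w.re := by
    intro w hw
    have h := (abs_re_le_norm (w - n)).trans (mem_closedBall_iff_norm.1 hw)
    rw [sub_re, natCast_re, abs_le] at h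
    linarith
  have hlow : ∀ w ∈ sphere (n : ℂ) (n + d), ∀ m : ℕ, m ≤ n → m + d ≤ ‖w - m‖ := by
    intro w hw m hm
    have hmn : (m : ℝ) ≤ n := by exact_mod_cast hm
    have h1 : ‖w - n‖ = n + d := mem_sphere_iff_norm.1 hw
    have h2 : ‖(n : ℂ) - m‖ = n - m := by
      rw [← ofReal_natCast, ← ofReal_natCast, ← ofReal_sub, norm_real,
        Real.norm_of_nonneg (by linarith)]
    have h3 := norm_sub_le (w - m) (n - m : ℂ)
    rw [sub_sub_sub_cancel_right] at h3
    linarith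
  have hne : ∀ w ∈ sphere (n : ℂ) (n + d), ∀ m : ℕ, m ≤ n → w - m ≠ 0 := by
    intro w hw m hm h
    have := hlow w hw m hm
    rw [h, norm_zero] at this
    linarith [m.cast_nonneg (α := ℝ)]
  have hfd : DiffContOnCl ℂ f (ball (n : ℂ) (n + d)) :=
    DifferentiableOn.diffContOnCl fun z hz =>
      (hf z (hre z (closure_ball_subset_closedBall hz))).differentiableWithinAt
  have hfc : ContinuousOn f (sphere (n : ℂ) (n + d)) :=
    hfd.continuousOn_ball.mono sphere_subset_closedBall
  have h0 : (0 : ℂ) ∈ ball (n : ℂ) (n + d) := by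
    rw [mem_ball, dist_zero_left, norm_natCast]
    linarith
  have hderiv := two_pi_I_inv_smul_circleIntegral_sub_sq_inv_smul_of_differentiable
    (isOpen_lt continuous_const continuous_re : IsOpen {z : ℂ | -(2 * d) < z.re}) hre
    (fun z hz => (hf z hz).differentiableWithinAt) h0
  have hprod : ∀ w ∈ sphere (n : ℂ) (n + d), ∀ l ≤ n,
      ∏ i ∈ Finset.range (l + 1), (w - (0 + i : ℕ)) ≠ 0 := fun w hw l hl =>
    Finset.prod_ne_zero_iff.2 fun i hi => by
      simpa using hne w hw i (by have := Finset.mem_range.1 hi; omega)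
  have hterm : ∀ l ∈ Finset.range n, CircleIntegrable (fun w : ℂ => (-1) ^ l / ((l : ℂ) + 1) *
      (((l + 1).factorial / ∏ i ∈ Finset.range (l + 1 + 1), (w - (0 + i : ℕ))) * f w))
      n (n + d) := fun l hl =>
    ContinuousOn.circleIntegrable hR (continuousOn_const.mul
      ((continuousOn_const.div (by fun_prop) fun w hw =>
        hprod w hw (l + 1) (by have := Finset.mem_range.1 hl; omega)).mul hfc))
  have hrem : CircleIntegrable (fun w : ℂ => (-1) ^ n * n.factorial /
      (w * ∏ i ∈ Finset.range (n + 1), (w - (0 + i : ℕ))) * f w) n (n + d) :=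
    ContinuousOn.circleIntegrable hR ((continuousOn_const.div (by fun_prop) fun w hw =>
      mul_ne_zero (by simpa using hne w hw 0 n.zero_le) (hprod w hw n le_rfl)).mul hfc)
  have hsplit : deriv f 0 -
      ∑ l ∈ Finset.range n, (-1) ^ l / ((l : ℂ) + 1) * (dSeq^[l + 1] s 0 : ℝ) =
      Real.circleAverage (fun w : ℂ => (w - n) * ((-1) ^ n * n.factorial /
        (w * ∏ i ∈ Finset.range (n + 1), (w - (0 + i : ℕ))) * f w)) n (n + d) := by
    have hkernel : (∮ w in C((n : ℂ), n + d), ((w - 0) ^ 2)⁻¹ • f w) =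
        ∮ w in C((n : ℂ), n + d), ((∑ l ∈ Finset.range n, (-1) ^ l / ((l : ℂ) + 1) *
      (((l + 1).factorial / ∏ i ∈ Finset.range (l + 1 + 1), (w - (0 + i : ℕ))) * f w)) +
      (-1) ^ n * n.factorial /
      (w * ∏ i ∈ Finset.range (n + 1), (w - (0 + i : ℕ))) * f w) := by
      refine circleIntegral.integral_congr hR fun w hw => ?_
      simp only [sub_zero, smul_eq_mul]
      rw [newton_kernel n (hne w hw), add_mul, Finset.sum_mul]
      simp only [mul_assoc]
    rw [← hderiv, hkernel, circleIntegral.integral_add (CircleIntegrable.fun_sum _ hterm) hrem,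
      circleIntegral.integral_fun_sum hterm, smul_add, Finset.smul_sum]
    have hsum : ∀ l ∈ Finset.range n, (2 * Real.pi * I : ℂ)⁻¹ • (∮ w in C((n : ℂ), n + d),
        (-1) ^ l / ((l : ℂ) + 1) *
        (((l + 1).factorial / ∏ i ∈ Finset.range (l + 1 + 1), (w - (0 + i : ℕ))) * f w)) =
        (-1) ^ l / ((l : ℂ) + 1) * (dSeq^[l + 1] s 0 : ℝ) := by
      intro l hl
      rw [cast_iterate_dSeq_eq_circleIntegral hd hfd hs (l + 1) 0
        (by have := Finset.mem_range.1 hl; omega), circleIntegral.integral_const_mul,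
        smul_eq_mul, smul_eq_mul, mul_left_comm]
    rw [Finset.sum_congr rfl hsum, add_sub_cancel_left,
      Real.circleAverage_eq_circleIntegral (by positivity)]
    congr 1
    refine circleIntegral.integral_congr hR fun w hw => ?_
    have := hne w hw n le_rfl
    simp only [smul_eq_mul]
    field_simp
  rw [hsplit]
  refine norm_circleAverage_le_of_norm_le_mul_poissonKernel h0 fun w hw => ?_
  have hC : 0 ≤ C := (norm_nonneg _).trans (hb 0 (by simpa using hd))
  have hfw := hb w (hre w (sphere_subset_closedBall hw))
  have hw0 : 0 < ‖w‖ := by simpa using hne w hw 0 n.zero_le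
  have hP : (n.factorial : ℝ) * ∏ i ∈ Finset.range n, (1 + d / (1 + (i : ℝ))) ≤
      ∏ i ∈ Finset.range n, ‖w - (i + 1 : ℕ)‖ := by
    rw [← Finset.prod_range_add_one_eq_factorial, Nat.cast_prod, ← Finset.prod_mul_distrib]
    refine Finset.prod_le_prod (fun i _ => by positivity) fun i hi => ?_
    refine le_trans (le_of_eq ?_) (hlow w hw (i + 1) (by have := Finset.mem_range.1 hi; omega))
    push_cast
    field_simp
    ring
  have hP0 : 0 < ∏ i ∈ Finset.range n, (1 + d / (1 + (i : ℝ))) :=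
    Finset.prod_pos fun i _ => by positivity
  rw [Finset.prod_range_succ', poissonKernel_def, sub_sub_sub_cancel_right, sub_zero, zero_sub,
    norm_neg, norm_natCast, mem_sphere_iff_norm.1 hw]
  simp only [norm_mul, norm_div, norm_pow, norm_neg, norm_one, one_pow, one_mul, norm_natCast,
    norm_prod, mem_sphere_iff_norm.1 hw, zero_add, Nat.cast_zero, sub_zero]
  have hQ : (n.factorial : ℝ) / ∏ i ∈ Finset.range n, ‖w - (i + 1 : ℕ)‖ ≤
      (∏ i ∈ Finset.range n, (1 + d / (1 + (i : ℝ))))⁻¹ := by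
    have : 0 < (n.factorial : ℝ) := by positivity
    rw [div_le_iff₀ (lt_of_lt_of_le (by positivity) hP), inv_mul_eq_div, le_div_iff₀ hP0]
    exact hP
  have hp : 0 ≤ (∏ i ∈ Finset.range n, (1 + d / (1 + (i : ℝ))))⁻¹ := inv_nonneg.2 hP0.le
  generalize (∏ i ∈ Finset.range n, (1 + d / (1 + (i : ℝ))))⁻¹ = p at *
  generalize ∏ i ∈ Finset.range n, ‖w - (i + 1 : ℕ)‖ = q at *
  have hnd : (n + d : ℝ) ≤ ((n + d) ^ 2 - n ^ 2) / d := by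
    rw [le_div_iff₀ hd]
    nlinarith
  have hnd0 := hR.trans hnd
  have hq : 0 < q := lt_of_lt_of_le (by positivity) hP
  calc (n + d) * (n.factorial / (‖w‖ * (q * ‖w‖)) * ‖f w‖)
      = (n + d) * (n.factorial / q * ‖f w‖) / ‖w‖ ^ 2 := by
        field_simp
    _ ≤ (((n + d) ^ 2 - n ^ 2) / d) * (p * C) / ‖w‖ ^ 2 := by
        gcongr
    _ = C / d * p * (((n + d) ^ 2 - n ^ 2) / ‖w‖ ^ 2) := by
        field_simp

lemma re_deriv_zero_nonpos_of_compMono {f : ℂ → ℂ} {s : ℕ → ℝ} {d C : ℝ} (hd : 0 < d)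
    (hf : ∀ z : ℂ, -(2 * d) < z.re → DifferentiableAt ℂ f z)
    (hb : ∀ z : ℂ, -(2 * d) < z.re → ‖f z‖ ≤ C) (hs : ∀ m : ℕ, f m = s m) (hcm : CompMono s) :
    (deriv f 0).re ≤ 0 := by
  have hlim := ((tendsto_prod_range_one_add_div_atTop hd one_pos).inv_tendsto_atTop).const_mul
    (C / d)
  rw [mul_zero] at hlim
  refine ge_of_tendsto' hlim fun n => ?_
  have hre : (∑ l ∈ Finset.range n, (-1) ^ l / ((l : ℂ) + 1) * (dSeq^[l + 1] s 0 : ℝ)).re ≤ 0 := by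
    rw [re_sum]
    refine Finset.sum_nonpos fun l _ => ?_
    have h : (-1) ^ l / ((l : ℂ) + 1) * (dSeq^[l + 1] s 0 : ℝ) =
        ((-((-1) ^ (l + 1) * dSeq^[l + 1] s 0 / (l + 1)) : ℝ) : ℂ) := by
      push_cast
      ring
    rw [h, ofReal_re, neg_nonpos]
    exact div_nonneg (hcm (l + 1) 0) (by positivity)
  have := (re_le_norm _).trans (norm_deriv_sub_newton_le hd hf hb hs n)
  rw [sub_re] at this
  simp only [Pi.inv_apply]
  linarith

lemma iterate_d1_apply (g : ℕ → ℕ → ℝ) (j m n : ℕ) :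
    d1^[j] g m n = dSeq^[j] (fun m => g m n) m := by
  induction j generalizing m with
  | zero => rfl
  | succ j ih => simp only [Function.iterate_succ_apply', d1, dSeq, ih]

lemma iterate_dSeq_const_mul (c : ℝ) (s : ℕ → ℝ) (j m : ℕ) :
    dSeq^[j] (fun m => c * s m) m = c * dSeq^[j] s m := by
  induction j generalizing m with
  | zero => rfl
  | succ j ih => simp only [Function.iterate_succ_apply', dSeq, ih, mul_sub]

lemma iterate_d2_inv_mul_add {a r : ℕ → ℝ} (ha : ∀ m, 0 < a m) (hr : ∀ m, 0 < r m) (β m n : ℕ) :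
    d2^[β] (fun m n => (a m * (r m + n))⁻¹) m n =
      (-1) ^ β * β.factorial * (a m * ∏ i ∈ Finset.range (β + 1), (r m + n + i))⁻¹ := by
  have hpos : ∀ x : ℕ, 0 < r m + x := fun x => add_pos_of_pos_of_nonneg (hr m) x.cast_nonneg
  have ham := (ha m).ne'
  induction β generalizing n with
  | zero => simp
  | succ β ih =>
    have hmid : ∏ i ∈ Finset.range β, (r m + (n + 1 : ℕ) + i) ≠ 0 :=
      Finset.prod_ne_zero_iff.2 fun i _ => by
        have := hpos (n + 1 + i)
        push_cast at this ⊢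
        linarith
    have h0 := (hpos n).ne'
    have h1 := (hpos (n + 1 + β)).ne'
    have e1 : ∏ i ∈ Finset.range (β + 1), (r m + n + i) =
        (r m + n) * ∏ i ∈ Finset.range β, (r m + (n + 1 : ℕ) + i) := by
      rw [Finset.prod_range_succ', mul_comm, Nat.cast_zero, add_zero]
      congr 1
      exact Finset.prod_congr rfl fun i _ => by push_cast; ring
    have e2 : ∏ i ∈ Finset.range (β + 1), (r m + (n + 1 : ℕ) + i) =
        (∏ i ∈ Finset.range β, (r m + (n + 1 : ℕ) + i)) * (r m + (n + 1 + β : ℕ)) := by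
      rw [Finset.prod_range_succ]
      congr 1
      push_cast; ring
    have e3 : ∏ i ∈ Finset.range (β + 1 + 1), (r m + n + i) =
        (r m + n) * (∏ i ∈ Finset.range β, (r m + (n + 1 : ℕ) + i)) * (r m + (n + 1 + β : ℕ)) := by
      rw [Finset.prod_range_succ, e1]
      congr 1
      push_cast; ring
    rw [Function.iterate_succ_apply', d2, ih, ih, e1, e2, e3, Nat.factorial_succ]
    generalize ∏ i ∈ Finset.range β, (r m + (n + 1 : ℕ) + i) = p at *
    field_simp
    push_cast
    ring

lemma JointCompMono.compMono_inv_mul_prod {a r : ℕ → ℝ} (ha : ∀ m, 0 < a m) (hr : ∀ m, 0 < r m)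
    (h : JointCompMono fun m n => (a m * (r m + n))⁻¹) (n β : ℕ) :
    CompMono fun m => (a m * ∏ i ∈ Finset.range (β + 1), (r m + n + i))⁻¹ := by
  intro j m
  have h' := h j β m n
  simp only [iterate_d1_apply, iterate_d2_inv_mul_add ha hr, iterate_dSeq_const_mul] at h'
  have hsq : ((-1 : ℝ) ^ β) * (-1) ^ β = 1 := by rw [← mul_pow]; simp
  refine nonneg_of_mul_nonneg_right (a := (β.factorial : ℝ)) (h'.trans_eq ?_) (by positivity)
  rw [pow_add]
  linear_combination (-1 : ℝ) ^ j * β.factorial *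
    dSeq^[j] (fun m => (a m * ∏ i ∈ Finset.range (β + 1), (r m + n + i))⁻¹) m * hsq

lemma monotone_of_forall_compMono {a r : ℕ → ℝ} (ha : ∀ m, 0 < a m) (hr : ∀ m, 0 < r m)
    (h : ∀ β, CompMono fun m => (a m * ∏ i ∈ Finset.range (β + 1), (r m + (0 : ℕ) + i))⁻¹) :
    Monotone r := by
  refine monotone_nat_of_le_succ fun m => ?_
  by_contra! hlt
  have htend := (tendsto_add_atTop_iff_nat 1).2
    (tendsto_prod_range_one_add_div_atTop (sub_pos.2 hlt) (hr (m + 1)))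
  obtain ⟨β, hβ⟩ := (htend.eventually_gt_atTop (a (m + 1) / a m)).exists
  have hanti := h β 1 m
  simp only [Function.iterate_one, dSeq, pow_one, neg_one_mul, neg_sub, sub_nonneg, Nat.cast_zero,
    add_zero] at hanti
  have hpos : ∀ m, 0 < ∏ i ∈ Finset.range (β + 1), (r m + i) := fun m =>
    Finset.prod_pos fun i _ => add_pos_of_pos_of_nonneg (hr m) i.cast_nonneg
  rw [inv_le_inv₀ (mul_pos (ha _) (hpos _)) (mul_pos (ha _) (hpos _))] at hanti
  have hprod : ∏ i ∈ Finset.range (β + 1), (1 + (r m - r (m + 1)) / (r (m + 1) + i)) =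
      (∏ i ∈ Finset.range (β + 1), (r m + i)) / ∏ i ∈ Finset.range (β + 1), (r (m + 1) + i) := by
    rw [← Finset.prod_div_distrib]
    refine Finset.prod_congr rfl fun i _ => ?_
    have := (add_pos_of_pos_of_nonneg (hr (m + 1)) (i.cast_nonneg (α := ℝ))).ne'
    field_simp
    ring
  rw [hprod, div_lt_div_iff₀ (ha m) (hpos _)] at hβ
  linarith

lemma HasDerivAt.fun_finsetProd_of_ne_zero {𝕜 ι : Type*} [NontriviallyNormedField 𝕜]
    {u : Finset ι} {f : ι → 𝕜 → 𝕜} {f' : ι → 𝕜} {x : 𝕜}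
    (hf : ∀ i ∈ u, HasDerivAt (f i) (f' i) x) (h0 : ∀ i ∈ u, f i x ≠ 0) :
    HasDerivAt (fun y => ∏ i ∈ u, f i y) ((∏ i ∈ u, f i x) * ∑ i ∈ u, f' i / f i x) x := by
  classical
  refine (HasDerivAt.fun_finsetProd hf).congr_deriv ?_
  rw [Finset.mul_sum]
  refine Finset.sum_congr rfl fun i hi => ?_
  rw [← Finset.mul_prod_erase u (fun i => f i x) hi, smul_eq_mul]
  have := h0 i hi
  field_simp

lemma nonneg_deriv_of_forall_compMono {α ρ : ℂ → ℂ} {a r : ℕ → ℝ} {u v d ε M : ℝ} (hd : 0 < d)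
    (hε : 0 < ε) (hα : ∀ z : ℂ, -(2 * d) < z.re → DifferentiableAt ℂ α z)
    (hρ : ∀ z : ℂ, -(2 * d) < z.re → DifferentiableAt ℂ ρ z)
    (hαε : ∀ z : ℂ, -(2 * d) < z.re → ε ≤ ‖α z‖) (hρM : ∀ z : ℂ, -(2 * d) < z.re → ‖ρ z‖ ≤ M)
    (hαa : ∀ m : ℕ, α m = a m) (hρr : ∀ m : ℕ, ρ m = r m) (ha : 0 < a 0) (hr : 0 < r 0)
    (hu : HasDerivAt α u 0) (hv : HasDerivAt ρ v 0)
    (hcm : ∀ n β : ℕ, CompMono fun m => (a m * ∏ i ∈ Finset.range (β + 1), (r m + n + i))⁻¹) :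
    0 ≤ v := by
  obtain ⟨N, hN⟩ := exists_nat_ge (M + 1)
  by_contra! hlt
  have hrN : 0 < r 0 + N := add_pos_of_pos_of_nonneg hr N.cast_nonneg
  obtain ⟨β, hβ⟩ := (((tendsto_add_atTop_iff_nat 1).2
    (tendsto_sum_range_div_add_atTop (neg_pos.2 hlt) hrN)).eventually_gt_atTop (u / a 0)).exists
  have hlow : ∀ z : ℂ, -(2 * d) < z.re → ∀ i : ℕ, 1 ≤ ‖ρ z + N + i‖ := by
    intro z hz i
    have h1 := norm_sub_le (ρ z + N + i) (ρ z)
    have h2 : ‖ρ z + N + i - ρ z‖ = N + i := by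
      rw [show ρ z + N + i - ρ z = ((N + i : ℕ) : ℂ) by push_cast; ring, norm_natCast]
      push_cast
      rfl
    linarith [hρM z hz, i.cast_nonneg (α := ℝ)]
  have hden : ∀ z : ℂ, -(2 * d) < z.re →
      ε ≤ ‖α z * ∏ i ∈ Finset.range (β + 1), (ρ z + N + i)‖ := by
    intro z hz
    rw [norm_mul, norm_prod]
    have h1 : 1 ≤ ∏ i ∈ Finset.range (β + 1), ‖ρ z + N + i‖ := by
      simpa using Finset.prod_le_prod (s := Finset.range (β + 1)) (f := fun _ => (1 : ℝ))
        (fun _ _ => zero_le_one) fun i _ => hlow z hz i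
    nlinarith [hαε z hz]
  have hne : ∀ z : ℂ, -(2 * d) < z.re →
      α z * ∏ i ∈ Finset.range (β + 1), (ρ z + N + i) ≠ 0 := fun z hz =>
    norm_pos_iff.1 (hε.trans_le (hden z hz))
  have hα0 : α 0 = a 0 := by simpa using hαa 0
  have hρ0 : ρ 0 = r 0 := by simpa using hρr 0
  have hmain := re_deriv_zero_nonpos_of_compMono (C := ε⁻¹) hd
    (f := fun z => (α z * ∏ i ∈ Finset.range (β + 1), (ρ z + N + i))⁻¹)
    (s := fun m => (a m * ∏ i ∈ Finset.range (β + 1), (r m + N + i))⁻¹)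
    (fun z hz => ((hα z hz).mul (DifferentiableAt.fun_finsetProd fun i _ =>
      ((hρ z hz).add_const _).add_const _)).inv (hne z hz))
    (fun z hz => by
      rw [norm_inv]
      exact inv_anti₀ hε (hden z hz))
    (fun m => by rw [hαa, hρr]; push_cast; rfl) (hcm N β)
  have hz0 : -(2 * d) < (0 : ℂ).re := by simpa using hd
  have hprod := HasDerivAt.fun_finsetProd_of_ne_zero (u := Finset.range (β + 1))
    (fun i _ => (hv.add_const (N : ℂ)).add_const (i : ℂ))
    (fun i _ => norm_pos_iff.1 (one_pos.trans_le (hlow 0 hz0 i)))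
  rw [((hu.fun_mul hprod).fun_inv (hne 0 hz0)).deriv, hα0, hρ0] at hmain
  have hP : 0 < ∏ i ∈ Finset.range (β + 1), (r 0 + N + i) :=
    Finset.prod_pos fun i _ => add_pos_of_pos_of_nonneg hrN i.cast_nonneg
  have hsum : ∑ i ∈ Finset.range (β + 1), v / (r 0 + N + i) < -(u / a 0) := by
    simp only [neg_div, Finset.sum_neg_distrib] at hβ
    linarith
  norm_cast at hmain
  generalize ∏ i ∈ Finset.range (β + 1), (r 0 + N + i) = p at *
  generalize ∑ i ∈ Finset.range (β + 1), v / (r 0 + N + i) = q at *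
  rw [div_nonpos_iff] at hmain
  have hneg : u * p + a 0 * (p * q) < 0 := by
    have h := mul_lt_mul_of_pos_left hsum (mul_pos ha hP)
    have h' : a 0 * p * -(u / a 0) = -(u * p) := by field_simp
    linarith
  have hsq : 0 < (a 0 * p) ^ 2 := pow_pos (mul_pos ha hP) 2
  rcases hmain with h | h <;> linarith [h.1, h.2]

lemma deriv_le_deriv_of_forall_one_div_nat {f g : ℝ → ℝ} {f' g' : ℝ} (hf : HasDerivAt f f' 0)
    (hg : HasDerivAt g g' 0) (h0 : f 0 = g 0)
    (h : ∀ n : ℕ, f (1 / ((n : ℝ) + 1)) ≤ g (1 / ((n : ℝ) + 1))) : f' ≤ g' := by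
  have hseq : Tendsto (fun n : ℕ => 1 / ((n : ℝ) + 1)) atTop (𝓝[≠] 0) :=
    tendsto_nhdsWithin_iff.2 ⟨tendsto_one_div_add_atTop_nhds_zero_nat,
      Eventually.of_forall fun n => (Nat.one_div_pos_of_nat).ne'⟩
  refine le_of_tendsto_of_tendsto' (hf.tendsto_slope.comp hseq) (hg.tendsto_slope.comp hseq)
    fun n => ?_
  have : 0 < 1 / ((n : ℝ) + 1) := Nat.one_div_pos_of_nat
  simp only [Function.comp_apply, slope_def_field, h0, sub_zero]
  gcongr
  exact h n

lemma sum_le_sum_of_prod_nat_add_le {ι : Type*} {S : Finset ι} {x y : ι → ℝ}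
    (h : ∀ m : ℕ, ∏ j ∈ S, ((m : ℝ) + x j) ≤ ∏ j ∈ S, ((m : ℝ) + y j)) :
    ∑ j ∈ S, x j ≤ ∑ j ∈ S, y j := by
  have hderiv : ∀ x : ι → ℝ,
      HasDerivAt (fun t : ℝ => ∏ j ∈ S, (1 + t * x j)) (∑ j ∈ S, x j) 0 := by
    intro x
    have := HasDerivAt.fun_finsetProd_of_ne_zero (u := S) (x := (0 : ℝ))
      (fun j _ => ((hasDerivAt_id (0 : ℝ)).mul_const (x j)).const_add 1) (by simp)
    simpa using this
  refine deriv_le_deriv_of_forall_one_div_nat (hderiv x) (hderiv y) (by simp) fun n => ?_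
  have hn : (0 : ℝ) < n + 1 := by positivity
  have hscale : ∀ x : ι → ℝ, ∏ j ∈ S, (1 + 1 / ((n : ℝ) + 1) * x j) =
      ((n + 1 : ℝ)⁻¹) ^ S.card * ∏ j ∈ S, (((n + 1 : ℕ) : ℝ) + x j) := by
    intro x
    rw [← Finset.prod_const, ← Finset.prod_mul_distrib]
    refine Finset.prod_congr rfl fun j _ => ?_
    push_cast
    field_simp
  rw [hscale, hscale]
  exact mul_le_mul_of_nonneg_left (h (n + 1)) (by positivity)

lemma tendsto_prod_nat_add_div_nat_add {ι : Type*} (S : Finset ι) (x y : ι → ℝ) :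
    Tendsto (fun m : ℕ => ∏ j ∈ S, ((m : ℝ) + x j) / ((m : ℝ) + y j)) atTop (𝓝 1) := by
  rw [show (1 : ℝ) = ∏ j ∈ S, (1 : ℝ) by simp]
  refine tendsto_finsetProd S fun j _ => ?_
  simpa [add_comm] using tendsto_add_mul_div_add_mul_atTop_nhds (x j) (y j) (1 : ℝ)
    (d := 1) one_ne_zero

theorem statement1 (k : ℕ) (hk : 0 < k) (a₀ b₀ : ℝ) (ha₀ : 0 < a₀) (hb₀ : 0 < b₀)
    (A B : ℕ → ℝ)
    (hA : ∀ j, 1 ≤ j → j ≤ k → 0 < A j) (hB : ∀ j, 1 ≤ j → j ≤ k → 0 < B j)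
    (hjcm : JointCompMono (fun m n =>
      1 / (b₀ * ∏ j ∈ Finset.Icc 1 k, ((m : ℝ) + B j) +
        (a₀ * ∏ j ∈ Finset.Icc 1 k, ((m : ℝ) + A j)) * n))) :
    (∑ j ∈ Finset.Icc 1 k, 1 / A j ≤ ∑ j ∈ Finset.Icc 1 k, 1 / B j) ∧
    (∏ j ∈ Finset.Icc 1 k, B j ≤ ∏ j ∈ Finset.Icc 1 k, A j) ∧
    (∑ j ∈ Finset.Icc 1 k, B j ≤ ∑ j ∈ Finset.Icc 1 k, A j) := by
  have hA' : ∀ j ∈ Finset.Icc 1 k, 0 < A j := fun j hj =>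
    hA j (Finset.mem_Icc.1 hj).1 (Finset.mem_Icc.1 hj).2
  have hB' : ∀ j ∈ Finset.Icc 1 k, 0 < B j := fun j hj =>
    hB j (Finset.mem_Icc.1 hj).1 (Finset.mem_Icc.1 hj).2
  obtain ⟨j₀, hj₀, hmin⟩ := Finset.exists_min_image (Finset.Icc 1 k) A
    ⟨1, Finset.mem_Icc.2 ⟨le_rfl, hk⟩⟩
  clear hA hB
  generalize Finset.Icc 1 k = S at *
  have hPA : ∀ m : ℕ, 0 < ∏ j ∈ S, ((m : ℝ) + A j) := fun m =>
    Finset.prod_pos fun j hj => add_pos_of_nonneg_of_pos m.cast_nonneg (hA' j hj)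
  have hPB : ∀ m : ℕ, 0 < ∏ j ∈ S, ((m : ℝ) + B j) := fun m =>
    Finset.prod_pos fun j hj => add_pos_of_nonneg_of_pos m.cast_nonneg (hB' j hj)
  have hc : 0 < b₀ / a₀ := div_pos hb₀ ha₀
  let a : ℕ → ℝ := fun m => a₀ * ∏ j ∈ S, ((m : ℝ) + A j)
  let r : ℕ → ℝ := fun m => b₀ / a₀ * ∏ j ∈ S, ((m : ℝ) + B j) / ((m : ℝ) + A j)
  have ha : ∀ m, 0 < a m := fun m => mul_pos ha₀ (hPA m)
  have hr : ∀ m, 0 < r m := fun m => by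
    simp only [r, Finset.prod_div_distrib]
    exact mul_pos hc (div_pos (hPB m) (hPA m))
  have hnet : JointCompMono fun m n => (a m * (r m + n))⁻¹ := by
    convert hjcm using 3 with m n
    rw [one_div]
    congr 1
    have := (hPA m).ne'
    simp only [a, r, Finset.prod_div_distrib]
    field_simp
  have hcm := hnet.compMono_inv_mul_prod ha hr
  have hmono : Monotone r := monotone_of_forall_compMono ha hr (hcm 0)
  have hprod : ∀ m : ℕ, ∏ j ∈ S, ((m : ℝ) + B j) ≤ ∏ j ∈ S, ((m : ℝ) + A j) := by
    intro m
    have h := hmono.ge_of_tendsto ((tendsto_prod_nat_add_div_nat_add S B A).const_mul (b₀ / a₀)) m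
    rw [mul_le_mul_iff_right₀ hc, Finset.prod_div_distrib, div_le_one (hPA m)] at h
    exact h
  refine ⟨?_, by simpa using hprod 0, sum_le_sum_of_prod_nat_add_le hprod⟩
  have hAj₀ := hA' j₀ hj₀
  have hlow : ∀ z : ℂ, -(2 * (A j₀ / 4)) < z.re → ∀ j ∈ S, A j₀ / 2 ≤ ‖z + A j‖ := by
    intro z hz j hj
    refine le_trans ?_ (re_le_norm _)
    rw [add_re, ofReal_re]
    linarith [hmin j hj]
  have hne : ∀ z : ℂ, -(2 * (A j₀ / 4)) < z.re → ∀ j ∈ S, z + A j ≠ 0 := fun z hz j hj =>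
    norm_pos_iff.1 ((half_pos hAj₀).trans_le (hlow z hz j hj))
  have hz0 : -(2 * (A j₀ / 4)) < (0 : ℂ).re := by
    rw [zero_re]
    linarith
  have hAne : ∀ j ∈ S, (A j : ℂ) ≠ 0 := fun j hj => ofReal_ne_zero.2 (hA' j hj).ne'
  have hBne : ∀ j ∈ S, (B j : ℂ) ≠ 0 := fun j hj => ofReal_ne_zero.2 (hB' j hj).ne'
  have hv := nonneg_deriv_of_forall_compMono (d := A j₀ / 4) (ε := a₀ * (A j₀ / 2) ^ S.card)
    (M := b₀ / a₀ * ∏ j ∈ S, (1 + |B j - A j| / (A j₀ / 2)))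
    (α := fun z => a₀ * ∏ j ∈ S, (z + A j))
    (ρ := fun z => (b₀ / a₀ : ℝ) * ∏ j ∈ S, ((z + B j) / (z + A j)))
    (u := a₀ * ((∏ j ∈ S, A j) * ∑ j ∈ S, 1 / A j))
    (v := b₀ / a₀ * ((∏ j ∈ S, B j / A j) * ∑ j ∈ S, (1 / B j - 1 / A j)))
    (by positivity) (by positivity) (by fun_prop)
    (fun z hz => (DifferentiableAt.fun_finsetProd fun j hj =>
      (differentiableAt_id.add_const _).div (differentiableAt_id.add_const _)
        (hne z hz j hj)).const_mul _)
    (fun z hz => by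
      rw [norm_mul, norm_prod, norm_real, Real.norm_of_nonneg ha₀.le, ← Finset.prod_const]
      gcongr with j hj
      exact hlow z hz j hj)
    (fun z hz => by
      rw [norm_mul, norm_prod, norm_real, Real.norm_of_nonneg hc.le]
      gcongr with j hj
      have h1 : (z + B j) / (z + A j) = 1 + ((B j - A j : ℝ) : ℂ) / (z + A j) := by
        have := hne z hz j hj
        field_simp
        push_cast
        ring
      rw [h1]
      refine (norm_add_le _ _).trans ?_
      rw [norm_one, norm_div, norm_real, Real.norm_eq_abs]
      gcongr
      exact hlow z hz j hj)
    (fun m => by simp [a]) (fun m => by simp [r]) (ha 0) (hr 0)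
    (by
      have h := (HasDerivAt.fun_finsetProd_of_ne_zero (u := S) (x := (0 : ℂ))
        (fun j _ => (hasDerivAt_id (0 : ℂ)).add_const (A j : ℂ))
        (fun j hj => hne 0 hz0 j hj)).const_mul (a₀ : ℂ)
      simpa using h)
    (by
      have h := (HasDerivAt.fun_finsetProd_of_ne_zero (u := S) (x := (0 : ℂ))
        (fun j hj => ((hasDerivAt_id (0 : ℂ)).add_const (B j : ℂ)).fun_div
          ((hasDerivAt_id (0 : ℂ)).add_const (A j : ℂ)) (hne 0 hz0 j hj))
        (fun j hj => by simpa using ⟨(hB' j hj).ne', (hA' j hj).ne'⟩)).const_mul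
        ((b₀ / a₀ : ℝ) : ℂ)
      refine h.congr_deriv ?_
      push_cast
      simp only [id_eq, zero_add]
      congr 2
      refine Finset.sum_congr rfl fun j hj => ?_
      have := hAne j hj
      have := hBne j hj
      field_simp)
    hcm
  have hpos : 0 < ∏ j ∈ S, B j / A j := Finset.prod_pos fun j hj => div_pos (hB' j hj) (hA' j hj)
  rw [← sub_nonneg, ← Finset.sum_sub_distrib]
  exact nonneg_of_mul_nonneg_right (nonneg_of_mul_nonneg_right hv hc) hpos
end
end

section
/- Let k be a positive integer, let a_0, b_0 > 0, let 0 < a_1 < a_2 < … < a_k, let b_1, …, b_k > 0, and set b(x) = b_0·∏_{l=1}^k (x + b_l). Fix j ∈ {1, …, k}, set d_j = a_0·∏_{1 ≤ l ≤ k, l ≠ j} (a_l − a_j) (the empty product being 1), and fix t ∈ (0,1). If (−1)^j · b(−a_j) < 0, then the sequence {t^{b(−a_j)/(d_j·(m + a_j))}}_{m ∈ ℤ₊} is not a Hausdorff moment sequence. -/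
noncomputable section

/-- A sequence is a Hausdorff moment sequence: moments of a finite Borel measure on [0,1]. -/
def HausdorffMoment (s : ℕ → ℝ) : Prop :=
  ∃ μ : MeasureTheory.Measure ℝ, MeasureTheory.IsFiniteMeasure μ ∧
    μ (Set.Icc (0 : ℝ) 1)ᶜ = 0 ∧ ∀ m : ℕ, s m = ∫ t, t ^ m ∂μ

open MeasureTheory in
/-- The first moment of a measure on `[0, 1]` is at most its mass. -/
theorem HausdorffMoment.apply_one_le_apply_zero {s : ℕ → ℝ} (h : HausdorffMoment s) :
    s 1 ≤ s 0 := by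
  obtain ⟨μ, hμ, hsupp, hs⟩ := h
  have hae : ∀ᵐ x ∂μ, x ∈ Set.Icc (0 : ℝ) 1 := by
    rw [ae_iff]
    exact hsupp
  rw [hs 1, hs 0]
  simp only [pow_one, pow_zero]
  refine integral_mono_of_nonneg ?_ (integrable_const 1) ?_
  · filter_upwards [hae] with x hx using hx.1
  · filter_upwards [hae] with x hx using hx.2

theorem lt_of_lt_succ_on_Icc {A : ℕ → ℝ} {k : ℕ}
    (hinc : ∀ l, 1 ≤ l → l < k → A l < A (l + 1)) {l m : ℕ} (hl : 1 ≤ l) (hlm : l < m)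
    (hm : m ≤ k) : A l < A m := by
  induction m, hlm using Nat.le_induction with
  | base => exact hinc l hl (by omega)
  | succ n hn ih => exact (ih (by omega)).trans (hinc n (by omega) (by omega))

/-- The product of the differences `A l - A j` over `l ≠ j` has the sign of `(-1) ^ (j - 1)`. -/
theorem neg_one_pow_mul_prod_erase_sub_neg {A : ℕ → ℝ} {k j : ℕ}
    (hinc : ∀ l, 1 ≤ l → l < k → A l < A (l + 1)) (hj1 : 1 ≤ j) (hjk : j ≤ k) :
    (-1 : ℝ) ^ j * ∏ l ∈ (Finset.Icc 1 k).erase j, (A l - A j) < 0 := by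
  have hsplit : (Finset.Icc 1 k).erase j = Finset.Ico 1 j ∪ Finset.Ioc j k := by
    ext l
    simp only [Finset.mem_erase, Finset.mem_Icc, Finset.mem_union, Finset.mem_Ico,
      Finset.mem_Ioc]
    omega
  have hdisj : Disjoint (Finset.Ico 1 j) (Finset.Ioc j k) := by
    rw [Finset.disjoint_left]
    intro l h1 h2
    simp only [Finset.mem_Ico, Finset.mem_Ioc] at h1 h2
    omega
  have hbelow : ∏ l ∈ Finset.Ico 1 j, (A l - A j) =
      (-1 : ℝ) ^ (j - 1) * ∏ l ∈ Finset.Ico 1 j, (A j - A l) := by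
    simp_rw [← neg_sub (A j)]
    rw [Finset.prod_neg, Nat.card_Ico]
  have hlow : 0 < ∏ l ∈ Finset.Ico 1 j, (A j - A l) := Finset.prod_pos fun l h => by
    rw [Finset.mem_Ico] at h
    exact sub_pos.2 (lt_of_lt_succ_on_Icc hinc h.1 h.2 hjk)
  have hhigh : 0 < ∏ l ∈ Finset.Ioc j k, (A l - A j) := Finset.prod_pos fun l h => by
    rw [Finset.mem_Ioc] at h
    exact sub_pos.2 (lt_of_lt_succ_on_Icc hinc hj1 h.1 h.2)
  rw [hsplit, Finset.prod_union hdisj, hbelow]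
  obtain ⟨n, rfl⟩ := Nat.exists_eq_add_of_le' hj1
  have hsq : (-1 : ℝ) ^ n * (-1) ^ n = 1 := by rw [← mul_pow]; simp
  rw [Nat.add_sub_cancel, pow_succ]
  calc _ = -((-1 : ℝ) ^ n * (-1) ^ n * ((∏ l ∈ Finset.Ico 1 (n + 1), (A (n + 1) - A l)) *
        ∏ l ∈ Finset.Ioc (n + 1) k, (A l - A (n + 1)))) := by ring
    _ < 0 := by rw [hsq, one_mul]; exact neg_neg_of_pos (mul_pos hlow hhigh)

theorem statement9 (k : ℕ) (hk : 0 < k) (a₀ b₀ : ℝ) (ha₀ : 0 < a₀) (hb₀ : 0 < b₀)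
    (A B : ℕ → ℝ)
    (hA : ∀ l, 1 ≤ l → l ≤ k → 0 < A l) (hB : ∀ l, 1 ≤ l → l ≤ k → 0 < B l)
    (hinc : ∀ l, 1 ≤ l → l < k → A l < A (l + 1))
    (j : ℕ) (hj1 : 1 ≤ j) (hjk : j ≤ k)
    (t : ℝ) (ht : t ∈ Set.Ioo (0 : ℝ) 1)
    (hsign : (-1 : ℝ) ^ j * (b₀ * ∏ l ∈ Finset.Icc 1 k, (B l - A j)) < 0) :
    ¬ HausdorffMoment (fun m =>
      t ^ ((b₀ * ∏ l ∈ Finset.Icc 1 k, (B l - A j)) /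
        ((a₀ * ∏ l ∈ (Finset.Icc 1 k).erase j, (A l - A j)) * ((m : ℝ) + A j)))) := by
  intro h
  have hle := h.apply_one_le_apply_zero
  have hprod := neg_one_pow_mul_prod_erase_sub_neg hinc hj1 hjk
  have hAj := hA j hj1 hjk
  set b := b₀ * ∏ l ∈ Finset.Icc 1 k, (B l - A j)
  set p := ∏ l ∈ (Finset.Icc 1 k).erase j, (A l - A j)
  have hc : 0 < b / (a₀ * p) := by
    have hpow : (-1 : ℝ) ^ j ≠ 0 := pow_ne_zero _ (by norm_num)
    have heq : b / (a₀ * p) = ((-1 : ℝ) ^ j * b) / ((-1) ^ j * p) / a₀ := by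
      rw [mul_div_mul_left _ _ hpow, div_div, mul_comm p]
    rw [heq]
    exact div_pos (div_pos_of_neg_of_neg hsign hprod) ha₀
  simp only [← div_div _ (a₀ * p)] at hle
  refine hle.not_gt (Real.rpow_lt_rpow_of_exponent_gt ht.1 ht.2 ?_)
  push_cast
  gcongr
  norm_num
end
end

section
/- Let a and b be real polynomials in one variable taking values in (0,∞) on ℝ₊, and let p(x,y) = b(x) + a(x)·y for x, y ≥ 0. If 1/p is a joint completely monotone function on ℝ₊², then: (1) a′(x)·b(x) ≤ a(x)·b′(x) for all x ≥ 0; (2) a(x₂)·b(x₁) ≤ a(x₁)·b(x₂) whenever 0 ≤ x₁ ≤ x₂; and (3) deg a ≤ deg b. -/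
noncomputable section

/-- Partial derivative in the first variable. -/
def pd1 (f : ℝ → ℝ → ℝ) : ℝ → ℝ → ℝ := fun x y => deriv (fun u => f u y) x

/-- Partial derivative in the second variable. -/
def pd2 (f : ℝ → ℝ → ℝ) : ℝ → ℝ → ℝ := fun x y => deriv (fun v => f x v) y

/-- A function of two variables is joint completely monotone on ℝ₊². -/
def JointCompMonoFun (f : ℝ → ℝ → ℝ) : Prop :=
  ∀ β₁ β₂ : ℕ, ∀ x y : ℝ, 0 ≤ x → 0 ≤ y →
    0 ≤ (-1 : ℝ) ^ (β₁ + β₂) * pd1^[β₁] (pd2^[β₂] f) x y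

open Polynomial

/-- Iterating `pd2` on a pointwise function is iterating `deriv` in the second variable. -/
lemma pd2_iterate (f : ℝ → ℝ → ℝ) (k : ℕ) : pd2^[k] f = fun x => deriv^[k] (f x) := by
  induction k with
  | zero => rfl
  | succ k ih =>
    rw [Function.iterate_succ_apply', ih]
    funext x y
    rw [Function.iterate_succ_apply']
    rfl

lemma pd2_iterate_one_div_affine (a b : ℝ → ℝ) (k : ℕ) (x : ℝ) :
    pd2^[k] (fun x y => 1 / (b x + a x * y)) x 0 =
      (-1) ^ k * k.factorial * (a x ^ k / b x ^ (k + 1)) := by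
  have h : (fun y => 1 / (b x + a x * y)) = fun y => (a x * y + b x)⁻¹ := by
    funext y
    rw [one_div, add_comm]
  rw [pd2_iterate]
  simp only [h]
  rw [iter_deriv_inv_linear]
  have e : (-1 - (k : ℤ)) = -((k + 1 : ℕ) : ℤ) := by push_cast; ring
  simp only [mul_zero, zero_add]
  rw [e, zpow_neg, zpow_natCast]
  ring

/-- Monotonicity in `x` of the `k`-th derivative in `y` at `y = 0`, for all `k`. -/
lemma JointCompMonoFun.mul_derivative_le {a b : Polynomial ℝ} {x : ℝ}
    (hjcm : JointCompMonoFun (fun x y => 1 / (b.eval x + a.eval x * y)))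
    (hx : 0 ≤ x) (ha : 0 < a.eval x) (hb : 0 < b.eval x) (k : ℕ) :
    (k + 1 : ℝ) * (a.derivative.eval x * b.eval x) ≤
      (k + 2 : ℝ) * (a.eval x * b.derivative.eval x) := by
  have h := hjcm 1 (k + 1) x 0 hx le_rfl
  have hd := (((a.hasDerivAt x).fun_pow (k + 1)).fun_div ((b.hasDerivAt x).fun_pow (k + 1 + 1))
    (pow_ne_zero _ hb.ne')).const_mul ((-1 : ℝ) ^ (k + 1) * (k + 1).factorial)
  have heq : pd1^[1] (pd2^[k + 1] fun x y => 1 / (b.eval x + a.eval x * y)) x 0 =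
      deriv (fun u => (-1) ^ (k + 1) * (k + 1).factorial *
        (a.eval u ^ (k + 1) / b.eval u ^ (k + 1 + 1))) x := by
    rw [Function.iterate_one, pd1]
    simp only [pd2_iterate_one_div_affine (fun x => a.eval x) (fun x => b.eval x)]
  rw [heq, hd.deriv, ← mul_assoc, ← mul_assoc, ← pow_add,
    show 1 + (k + 1) + (k + 1) = 2 * (k + 1) + 1 by ring, pow_succ, pow_mul] at h
  have hf : (0 : ℝ) < (k + 1).factorial := by positivity
  simp only [neg_one_sq, one_pow, one_mul, neg_mul, Left.nonneg_neg_iff] at h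
  have h1 := nonpos_of_mul_nonpos_right h hf
  rw [div_le_iff₀ (by positivity), zero_mul] at h1
  have hp : 0 < a.eval x ^ k * b.eval x ^ (k + 1) := by positivity
  rw [← sub_nonpos]
  refine nonpos_of_mul_nonpos_right (le_of_eq_of_le ?_ h1) hp
  simp only [Nat.add_sub_cancel]
  push_cast
  ring

theorem statement11 (a b : Polynomial ℝ)
    (ha : ∀ x : ℝ, 0 ≤ x → 0 < a.eval x) (hb : ∀ x : ℝ, 0 ≤ x → 0 < b.eval x)
    (hjcm : JointCompMonoFun (fun x y => 1 / (b.eval x + a.eval x * y))) :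
    (∀ x : ℝ, 0 ≤ x → (a.derivative.eval x) * b.eval x ≤ a.eval x * b.derivative.eval x) ∧
    (∀ x₁ x₂ : ℝ, 0 ≤ x₁ → x₁ ≤ x₂ → a.eval x₂ * b.eval x₁ ≤ a.eval x₁ * b.eval x₂) ∧
    a.natDegree ≤ b.natDegree := by
  have h1 : ∀ x : ℝ, 0 ≤ x →
      a.derivative.eval x * b.eval x ≤ a.eval x * b.derivative.eval x := by
    intro x hx
    by_contra! hlt
    obtain ⟨k, hk⟩ := exists_nat_gt ((a.eval x * b.derivative.eval x) /
      (a.derivative.eval x * b.eval x - a.eval x * b.derivative.eval x))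
    rw [div_lt_iff₀ (sub_pos.2 hlt)] at hk
    have := hjcm.mul_derivative_le hx (ha x hx) (hb x hx) k
    nlinarith
  have hanti : AntitoneOn (fun x => a.eval x / b.eval x) (Set.Ici 0) := by
    have hd : ∀ x ∈ Set.Ici (0 : ℝ), HasDerivAt (fun x => a.eval x / b.eval x) _ x :=
      fun x hx => (a.hasDerivAt x).div (b.hasDerivAt x) (hb x hx).ne'
    refine antitoneOn_of_deriv_nonpos (convex_Ici 0)
      (fun x hx => (hd x hx).continuousAt.continuousWithinAt)
      (fun x hx => (hd x (interior_subset hx)).differentiableAt.differentiableWithinAt)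
      fun x hx => ?_
    rw [(hd x (interior_subset hx)).deriv]
    exact div_nonpos_of_nonpos_of_nonneg (sub_nonpos.2 (h1 x (interior_subset hx))) (sq_nonneg _)
  refine ⟨h1, fun x₁ x₂ hx₁ hx => ?_, ?_⟩
  · have hx₂ := hx₁.trans hx
    exact (div_le_div_iff₀ (hb x₂ hx₂) (hb x₁ hx₁)).1 (hanti hx₁ hx₂ hx)
  · by_contra! hdeg
    have hb0 : b ≠ 0 := by
      rintro rfl
      simpa using hb 0 le_rfl
    have ht := a.abs_div_tendsto_atTop_atTop_of_degree_gt b (degree_lt_degree hdeg) hb0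
    obtain ⟨x, hxgt, hx⟩ := ((ht.eventually_gt_atTop (a.eval 0 / b.eval 0)).and
      (Filter.eventually_ge_atTop 0)).exists
    rw [abs_of_pos (div_pos (ha x hx) (hb x hx))] at hxgt
    exact hxgt.not_ge (hanti Set.self_mem_Ici hx hx)
end
end
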